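/- For all integers i, b with 2 ≤ i ≤ 11 and 2 ≤ b ≤ 4, the weight ω1 + ω5 + b·ω6 − i·ω2 + ρ is singular, i.e. there exists a root β ∈ R with ⟨ω1 + ω5 + b·ω6 − i·ω2 + ρ, β⟩ = 0. (By Borel–Weil–Bott this shows the bundles 𝒮^{ω1+ω5+bω6}(−i) on E6/P2 are acyclic in this range.) -/

import Mathlib

noncomputable section

/-- The ambient space ℚ^8. -/
abbrev V : Type := Fin 8 → ℚ

/-- The standard dot product on ℚ^8. -/
def dot (v w : V) : ℚ := ∑ j, v j * w j

/-- The standard basis vectors ε1, …, ε8 (zero-indexed). -/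
def ε (i : Fin 8) : V := fun j => if j = i then 1 else 0

/-- The simple roots α1, …, α6 of E6 in Bourbaki numbering (zero-indexed). -/
def α : Fin 6 → V :=
  ![(1/2 : ℚ) • (ε 0 + ε 7) - (1/2 : ℚ) • (ε 1 + ε 2 + ε 3 + ε 4 + ε 5 + ε 6),
    ε 0 + ε 1,
    ε 1 - ε 0,
    ε 2 - ε 1,
    ε 3 - ε 2,
    ε 4 - ε 3]

/-- The fundamental weights ω1, …, ω6 (zero-indexed). -/
def ω : Fin 6 → V :=
  ![(1/3 : ℚ) • (4 • α 0 + 3 • α 1 + 5 • α 2 + 6 • α 3 + 4 • α 4 + 2 • α 5),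
    α 0 + 2 • α 1 + 2 • α 2 + 3 • α 3 + 2 • α 4 + α 5,
    (1/3 : ℚ) • (5 • α 0 + 6 • α 1 + 10 • α 2 + 12 • α 3 + 8 • α 4 + 4 • α 5),
    2 • α 0 + 3 • α 1 + 4 • α 2 + 6 • α 3 + 4 • α 4 + 2 • α 5,
    (1/3 : ℚ) • (4 • α 0 + 6 • α 1 + 8 • α 2 + 12 • α 3 + 10 • α 4 + 5 • α 5),
    (1/3 : ℚ) • (2 • α 0 + 3 • α 1 + 4 • α 2 + 6 • α 3 + 5 • α 4 + 4 • α 5)]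

/-- The sum of the fundamental weights. -/
def ρ : V := ω 0 + ω 1 + ω 2 + ω 3 + ω 4 + ω 5

/-- The reflection in a vector `a` of squared length 2. -/
def reflect (a v : V) : V := v - dot v a • a

/-- The root system of E6: integral combinations of the simple roots of squared length 2. -/
def R : Set V := {v | (∃ c : Fin 6 → ℤ, v = ∑ i, (c i : ℚ) • α i) ∧ dot v v = 2}

/-- The squared length of a combination of simple roots is the E6 quadratic form. -/
theorem dot_self_sum_smul_α (c : Fin 6 → ℚ) :
    dot (∑ i, c i • α i) (∑ i, c i • α i) =
      2 * (c 0 ^ 2 + c 1 ^ 2 + c 2 ^ 2 + c 3 ^ 2 + c 4 ^ 2 + c 5 ^ 2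
        - c 0 * c 2 - c 2 * c 3 - c 1 * c 3 - c 3 * c 4 - c 4 * c 5) := by
  simp [dot, Fin.sum_univ_succ, α, ε]
  ring

/-- The simple roots and the fundamental weights are dual bases. -/
theorem dot_sum_smul_ω_sum_smul_α (x c : Fin 6 → ℚ) :
    dot (∑ i, x i • ω i) (∑ i, c i • α i) = ∑ i, x i * c i := by
  simp [dot, Fin.sum_univ_succ, ω, α, ε]
  ring

theorem sum_smul_α_mem_R (c : Fin 6 → ℤ)
    (h : c 0 ^ 2 + c 1 ^ 2 + c 2 ^ 2 + c 3 ^ 2 + c 4 ^ 2 + c 5 ^ 2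
        - c 0 * c 2 - c 2 * c 3 - c 1 * c 3 - c 3 * c 4 - c 4 * c 5 = 1) :
    ∑ i, (c i : ℚ) • α i ∈ R := by
  refine ⟨⟨c, rfl⟩, ?_⟩
  rw [dot_self_sum_smul_α (fun i => (c i : ℚ))]
  exact_mod_cast congrArg (2 * ·) h

/-- The weight `ω1 + ω5 + bω6 − iω2 + ρ` in the basis of fundamental weights. -/
theorem weight_eq_sum_smul_ω (i b : ℤ) :
    ω 0 + ω 4 + b • ω 5 - i • ω 1 + ρ =
      ∑ j, (![2, 1 - i, 1, 1, 2, b + 1] : Fin 6 → ℚ) j • ω j := by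
  simp only [ρ, Fin.sum_univ_six, ← Int.cast_smul_eq_zsmul ℚ]
  simp only [Matrix.cons_val]
  module

/-- A root with coordinates `c` and vanishing pairing witnesses singularity. -/
theorem exists_mem_R_dot_eq_zero {i b : ℤ} (c : Fin 6 → ℤ)
    (hc : c 0 ^ 2 + c 1 ^ 2 + c 2 ^ 2 + c 3 ^ 2 + c 4 ^ 2 + c 5 ^ 2
        - c 0 * c 2 - c 2 * c 3 - c 1 * c 3 - c 3 * c 4 - c 4 * c 5 = 1)
    (h : 2 * c 0 + (1 - i) * c 1 + c 2 + c 3 + 2 * c 4 + (b + 1) * c 5 = 0) :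
    ∃ β ∈ R, dot (ω 0 + ω 4 + b • ω 5 - i • ω 1 + ρ) β = 0 := by
  refine ⟨_, sum_smul_α_mem_R c hc, ?_⟩
  rw [weight_eq_sum_smul_ω, dot_sum_smul_ω_sum_smul_α _ (fun j => (c j : ℚ)),
    Fin.sum_univ_six]
  simp only [Matrix.cons_val, one_mul]
  exact_mod_cast h

/-- For 2 ≤ i ≤ 11 and 2 ≤ b ≤ 4, the weight ω1 + ω5 + bω6 − iω2 + ρ is singular. -/
theorem stmt_18 :
    ∀ i b : ℤ, 2 ≤ i → i ≤ 11 → 2 ≤ b → b ≤ 4 →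
      ∃ β ∈ R, dot (ω 0 + ω 4 + b • ω 5 - i • ω 1 + ρ) β = 0 := by
  intro i b hi hi' hb hb'
  interval_cases i
  · exact exists_mem_R_dot_eq_zero ![0, 1, 0, 1, 0, 0] (by simp) (by simp)
  · exact exists_mem_R_dot_eq_zero ![0, 1, 1, 1, 0, 0] (by simp) (by simp)
  · exact exists_mem_R_dot_eq_zero ![0, 1, 0, 1, 1, 0] (by simp) (by simp)
  · exact exists_mem_R_dot_eq_zero ![1, 1, 1, 1, 0, 0] (by simp) (by simp)
  · exact exists_mem_R_dot_eq_zero ![0, 1, 1, 2, 1, 0] (by simp) (by simp)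
  · exact exists_mem_R_dot_eq_zero ![1, 1, 1, 1, 1, 0] (by simp) (by simp)
  · exact exists_mem_R_dot_eq_zero ![1, 1, 1, 2, 1, 0] (by simp) (by simp)
  · exact exists_mem_R_dot_eq_zero ![1, 1, 2, 2, 1, 0] (by simp) (by simp)
  · interval_cases b
    · exact exists_mem_R_dot_eq_zero ![1, 1, 1, 1, 1, 1] (by simp) (by simp)
    · exact exists_mem_R_dot_eq_zero ![0, 1, 1, 2, 1, 1] (by simp) (by simp)
    · exact exists_mem_R_dot_eq_zero ![0, 1, 1, 1, 1, 1] (by simp) (by simp)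
  · interval_cases b
    · exact exists_mem_R_dot_eq_zero ![1, 1, 1, 2, 1, 1] (by simp) (by simp)
    · exact exists_mem_R_dot_eq_zero ![1, 1, 1, 1, 1, 1] (by simp) (by simp)
    · exact exists_mem_R_dot_eq_zero ![0, 1, 1, 2, 1, 1] (by simp) (by simp)
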